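/- arXiv:2405.16536 — 6 statements merged into one kernel-verified Lean document; each statement's English description precedes it below -/
import Mathlib

section
/- Assume Δ is irreducible and non-classical. Then for every nonzero λ ∈ V there exists α ∈ Δ₊^c such that (λ,α) < 0, or there exists β ∈ Δ₊^nc such that (λ,β) > 0. -/
open scoped RealInnerProductSpace

/-- A finite reduced crystallographic root system spanning a finite-dimensional
real inner product space `V`. -/
structure IsRootSystem {V : Type*} [NormedAddCommGroup V] [InnerProductSpace ℝ V]
    [FiniteDimensional ℝ V] (Δ : Set V) : Prop where
  finite : Δ.Finite
  zero_not_mem : (0 : V) ∉ Δ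
  span_eq_top : Submodule.span ℝ Δ = ⊤
  reflection_mem : ∀ α ∈ Δ, ∀ β ∈ Δ, β - (2 * ⟪β, α⟫ / ⟪α, α⟫) • α ∈ Δ
  crystallographic : ∀ α ∈ Δ, ∀ β ∈ Δ, ∃ n : ℤ, 2 * ⟪β, α⟫ / ⟪α, α⟫ = (n : ℝ)
  reduced : ∀ α ∈ Δ, ∀ c : ℝ, c • α ∈ Δ → c = 1 ∨ c = -1

/-- A partition `Δ = Δc ⊔ Δnc` into compact and noncompact roots, closed under
negation, and such that sums of roots obey the parity rules. -/
structure IsCompactDecomp {V : Type*} [NormedAddCommGroup V] [InnerProductSpace ℝ V]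
    [FiniteDimensional ℝ V] (Δ Δc Δnc : Set V) : Prop where
  union_eq : Δc ∪ Δnc = Δ
  inter_eq : Δc ∩ Δnc = ∅
  neg_c : ∀ α ∈ Δc, -α ∈ Δc
  neg_nc : ∀ α ∈ Δnc, -α ∈ Δnc
  add_cc : ∀ α ∈ Δc, ∀ β ∈ Δc, α + β ∈ Δ → α + β ∈ Δc
  add_ncnc : ∀ α ∈ Δnc, ∀ β ∈ Δnc, α + β ∈ Δ → α + β ∈ Δc
  add_cnc : ∀ α ∈ Δc, ∀ β ∈ Δnc, α + β ∈ Δ → α + β ∈ Δnc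

/-- A choice of positive roots `Δp` in the root system `Δ`. -/
structure IsPositiveSystem {V : Type*} [NormedAddCommGroup V] [InnerProductSpace ℝ V]
    [FiniteDimensional ℝ V] (Δ Δp : Set V) : Prop where
  subset : Δp ⊆ Δ
  mem_or_neg_mem : ∀ α ∈ Δ, α ∈ Δp ∨ -α ∈ Δp
  neg_not_mem : ∀ α ∈ Δp, -α ∉ Δp
  add_mem : ∀ α ∈ Δp, ∀ β ∈ Δp, α + β ∈ Δ → α + β ∈ Δp

/-- `Δ` is irreducible: it is not the union of two nonempty mutually orthogonal subsets. -/
def RootIrreducible {V : Type*} [NormedAddCommGroup V] [InnerProductSpace ℝ V]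
    [FiniteDimensional ℝ V] (Δ : Set V) : Prop :=
  ¬ ∃ Δ₁ Δ₂ : Set V, Δ₁.Nonempty ∧ Δ₂.Nonempty ∧ Δ₁ ∪ Δ₂ = Δ ∧
      ∀ α ∈ Δ₁, ∀ β ∈ Δ₂, ⟪α, β⟫ = 0

namespace IsRootSystem

variable {V : Type*} [NormedAddCommGroup V] [InnerProductSpace ℝ V] [FiniteDimensional ℝ V]
  {Δ : Set V}

lemma inner_self_pos (h : IsRootSystem Δ) {α : V} (hα : α ∈ Δ) : 0 < ⟪α, α⟫ :=
  real_inner_self_pos.2 fun h0 => h.zero_not_mem (h0 ▸ hα)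

lemma neg_mem (h : IsRootSystem Δ) {α : V} (hα : α ∈ Δ) : -α ∈ Δ := by
  have h1 := h.reflection_mem α hα α hα
  rw [mul_div_assoc, div_self (h.inner_self_pos hα).ne'] at h1
  convert h1 using 1
  module

/-- The difference of two distinct roots at an acute angle is a root. -/
lemma sub_mem_of_inner_pos (h : IsRootSystem Δ) {α β : V} (hα : α ∈ Δ) (hβ : β ∈ Δ)
    (hne : α ≠ β) (hpos : 0 < ⟪α, β⟫) : α - β ∈ Δ := by
  have hαα := h.inner_self_pos hα
  have hββ := h.inner_self_pos hβ
  obtain ⟨n, hn⟩ := h.crystallographic β hβ α hα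
  obtain ⟨m, hm⟩ := h.crystallographic α hα β hβ
  have hrβ := h.reflection_mem β hβ α hα
  have hrα := h.reflection_mem α hα β hβ
  rw [hn] at hrβ
  rw [hm] at hrα
  rw [real_inner_comm] at hm
  have hn' : 2 * ⟪α, β⟫ = n * ⟪β, β⟫ := (div_eq_iff hββ.ne').1 hn
  have hm' : 2 * ⟪α, β⟫ = m * ⟪α, α⟫ := (div_eq_iff hαα.ne').1 hm
  have hn0 : 0 < n := by
    have : (0 : ℝ) < n := hn ▸ by positivity
    exact_mod_cast this
  have hm0 : 0 < m := by
    have : (0 : ℝ) < m := hm ▸ by positivity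
    exact_mod_cast this
  by_cases hn1 : n = 1
  · simpa [hn1] using hrβ
  by_cases hm1 : m = 1
  · have := h.neg_mem hrα
    simpa [hm1] using this
  exfalso
  have hn2 : (2 : ℝ) ≤ n := by exact_mod_cast (by omega : (2 : ℤ) ≤ n)
  have hm2 : (2 : ℝ) ≤ m := by exact_mod_cast (by omega : (2 : ℤ) ≤ m)
  have hsub : ⟪α - β, α - β⟫ = ⟪α, α⟫ - 2 * ⟪α, β⟫ + ⟪β, β⟫ := real_inner_sub_sub_self α β
  have h1 : 2 * ⟪β, β⟫ ≤ n * ⟪β, β⟫ := by gcongr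
  have h2 : 2 * ⟪α, α⟫ ≤ m * ⟪α, α⟫ := by gcongr
  have h3 : ⟪α - β, α - β⟫ ≤ 0 := by linarith
  exact hne (sub_eq_zero.1 (real_inner_self_nonpos.1 h3))

/-- The sum of two roots at an obtuse angle is a root unless it vanishes. -/
lemma add_mem_of_inner_neg (h : IsRootSystem Δ) {α β : V} (hα : α ∈ Δ) (hβ : β ∈ Δ)
    (hne : α ≠ -β) (hneg : ⟪α, β⟫ < 0) : α + β ∈ Δ := by
  simpa using h.sub_mem_of_inner_pos hα (h.neg_mem hβ) hne (by simpa [inner_neg_right] using hneg)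

/-- In an irreducible root system, no root is orthogonal to all roots pairing positively with a
nonzero vector. -/
lemma not_forall_inner_eq_zero (h : IsRootSystem Δ) (hirr : RootIrreducible Δ) {lam β : V}
    (hlam : lam ≠ 0) (hβ : β ∈ Δ) : ¬ ∀ u ∈ Δ, 0 < ⟪lam, u⟫ → ⟪u, β⟫ = 0 := by
  intro horth
  obtain ⟨u₀, hu₀, hpos₀⟩ : ∃ u ∈ Δ, 0 < ⟪lam, u⟫ := by
    by_contra! hcon
    refine hlam (inner_self_eq_zero (𝕜 := ℝ).1 ?_)
    have hle : Submodule.span ℝ Δ ≤ LinearMap.ker (innerₛₗ ℝ lam) := by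
      rw [Submodule.span_le]
      intro u hu
      have h1 := hcon u hu
      have h2 := hcon (-u) (h.neg_mem hu)
      rw [inner_neg_right] at h2
      simp only [SetLike.mem_coe, LinearMap.mem_ker, innerₛₗ_apply_apply]
      linarith
    rw [h.span_eq_top] at hle
    simpa using hle (Submodule.mem_top (x := lam))
  refine hirr ⟨{δ ∈ Δ | ∀ u ∈ Δ, 0 < ⟪lam, u⟫ → ⟪u, δ⟫ = 0},
    {δ ∈ Δ | ¬ ∀ u ∈ Δ, 0 < ⟪lam, u⟫ → ⟪u, δ⟫ = 0}, ⟨β, hβ, horth⟩,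
    ⟨u₀, hu₀, fun h0 => (h.inner_self_pos hu₀).ne' (h0 u₀ hu₀ hpos₀)⟩, ?_, ?_⟩
  · ext δ
    simp only [Set.mem_union, Set.mem_ofPred_eq]
    tauto
  rintro δ ⟨-, hδ⟩ l ⟨hl, hl'⟩
  rw [real_inner_comm]
  rcases lt_trichotomy ⟪lam, l⟫ 0 with hneg | h0 | hpos
  · simpa [inner_neg_left] using hδ (-l) (h.neg_mem hl) (by simpa [inner_neg_right] using hneg)
  · push Not at hl'
    obtain ⟨u, hu, hupos, hul⟩ := hl'
    have hrefl := hδ _ (h.reflection_mem l hl u hu)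
      (by rwa [inner_sub_right, inner_smul_right, h0, mul_zero, sub_zero])
    rw [inner_sub_left, hδ u hu hupos, real_inner_smul_left, zero_sub, neg_eq_zero] at hrefl
    refine (mul_eq_zero.1 hrefl).resolve_left ?_
    exact div_ne_zero (mul_ne_zero two_ne_zero hul) (h.inner_self_pos hl).ne'
  · exact hδ l hl hpos

end IsRootSystem

/-- If `Δ` is irreducible and non-classical, then for every nonzero `λ` there is a positive
compact root pairing negatively with `λ`, or a positive noncompact root pairing positively. -/
theorem exists_neg_compact_or_pos_noncompact {V : Type*} [NormedAddCommGroup V]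
    [InnerProductSpace ℝ V] [FiniteDimensional ℝ V] (Δ Δc Δnc Δp : Set V)
    (hRS : IsRootSystem Δ) (hCD : IsCompactDecomp Δ Δc Δnc) (hPS : IsPositiveSystem Δ Δp)
    (hirr : RootIrreducible Δ)
    (hnonclassical : ∃ β₁ ∈ Δnc ∩ Δp, ∃ β₂ ∈ Δnc ∩ Δp, β₁ + β₂ ∈ Δ) :
    ∀ lam : V, lam ≠ 0 →
      (∃ α ∈ Δc ∩ Δp, ⟪lam, α⟫ < 0) ∨ (∃ β ∈ Δnc ∩ Δp, 0 < ⟪lam, β⟫) := by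
  intro lam hlam
  by_contra! hcon
  obtain ⟨hc, hnc⟩ := hcon
  obtain ⟨β₁, ⟨h₁, hp₁⟩, β₂, ⟨h₂, hp₂⟩, hsum⟩ := hnonclassical
  have cΔ : ∀ {α}, α ∈ Δc → α ∈ Δ := fun h => hCD.union_eq ▸ Or.inl h
  have ncΔ : ∀ {α}, α ∈ Δnc → α ∈ Δ := fun h => hCD.union_eq ▸ Or.inr h
  have hγ₀ : 0 ≤ ⟪lam, β₁ + β₂⟫ :=
    hc _ ⟨hCD.add_ncnc _ h₁ _ h₂ hsum, hPS.add_mem _ hp₁ _ hp₂ hsum⟩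
  rw [inner_add_right] at hγ₀
  have hz₁ : ⟪lam, β₁⟫ = 0 := by linarith [hnc _ ⟨h₁, hp₁⟩, hnc _ ⟨h₂, hp₂⟩]
  have hz₂ : ⟪lam, β₂⟫ = 0 := by linarith [hnc _ ⟨h₁, hp₁⟩, hnc _ ⟨h₂, hp₂⟩]
  have hz : ⟪lam, β₁ + β₂⟫ = 0 := by rw [inner_add_right, hz₁, hz₂, add_zero]
  have ne_of_zero : ∀ {u δ}, 0 < ⟪lam, u⟫ → ⟪lam, δ⟫ = 0 → u ≠ δ := by
    rintro u δ hu hδ rfl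
    exact hu.ne' hδ
  have c_pos : ∀ {u}, u ∈ Δc → 0 < ⟪lam, u⟫ → u ∈ Δp := by
    intro u hu hpos
    refine (hPS.mem_or_neg_mem u (cΔ hu)).resolve_right fun hn => ?_
    have := hc _ ⟨hCD.neg_c u hu, hn⟩
    rw [inner_neg_right] at this
    linarith
  have nc_neg : ∀ {u}, u ∈ Δnc → 0 < ⟪lam, u⟫ → -u ∈ Δp := by
    intro u hu hpos
    refine (hPS.mem_or_neg_mem u (ncΔ hu)).resolve_left fun hn => ?_
    exact hpos.not_ge (hnc _ ⟨hu, hn⟩)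
  have add_not_mem : ∀ {u β}, u ∈ Δc → 0 < ⟪lam, u⟫ → β ∈ Δnc → β ∈ Δp → ⟪lam, β⟫ = 0 →
      u + β ∉ Δ := by
    intro u β hu hpos hβ hβp hβ0 hmem
    refine hPS.neg_not_mem _ (hPS.add_mem u (c_pos hu hpos) β hβp hmem)
      (nc_neg (hCD.add_cnc u hu β hβ hmem) ?_)
    rwa [inner_add_right, hβ0, add_zero]
  have sub_not_mem : ∀ {u β}, u ∈ Δnc → 0 < ⟪lam, u⟫ → β ∈ Δnc → β ∈ Δp → ⟪lam, β⟫ = 0 →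
      u - β ∉ Δ := by
    intro u β hu hpos hβ hβp hβ0 hmem
    have hcomp : u - β ∈ Δc := by
      rw [sub_eq_add_neg] at hmem ⊢
      exact hCD.add_ncnc u hu _ (hCD.neg_nc β hβ) hmem
    have heq : -u + β = -(u - β) := by abel
    have hp : -(u - β) ∈ Δp :=
      heq ▸ hPS.add_mem _ (nc_neg hu hpos) β hβp (heq ▸ hRS.neg_mem hmem)
    refine hPS.neg_not_mem _ (c_pos hcomp ?_) hp
    rwa [inner_sub_right, hβ0, sub_zero]
  have inner_nonneg : ∀ {u β}, u ∈ Δc → 0 < ⟪lam, u⟫ → β ∈ Δnc → β ∈ Δp → ⟪lam, β⟫ = 0 →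
      0 ≤ ⟪u, β⟫ := by
    intro u β hu hpos hβ hβp hβ0
    by_contra! hneg
    exact add_not_mem hu hpos hβ hβp hβ0 (hRS.add_mem_of_inner_neg (cΔ hu) (ncΔ hβ)
      (ne_of_zero hpos (by rw [inner_neg_right, hβ0, neg_zero])) hneg)
  have inner_nonpos : ∀ {u β}, u ∈ Δnc → 0 < ⟪lam, u⟫ → β ∈ Δnc → β ∈ Δp → ⟪lam, β⟫ = 0 →
      ⟪u, β⟫ ≤ 0 := by
    intro u β hu hpos hβ hβp hβ0
    by_contra! hlt
    exact sub_not_mem hu hpos hβ hβp hβ0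
      (hRS.sub_mem_of_inner_pos (ncΔ hu) (ncΔ hβ) (ne_of_zero hpos hβ0) hlt)
  refine hRS.not_forall_inner_eq_zero hirr hlam (ncΔ h₁) fun u hu hpos => ?_
  rw [← hCD.union_eq] at hu
  rcases hu with hu | hu
  · refine le_antisymm (not_lt.1 fun hlt => ?_) (inner_nonneg hu hpos h₁ hp₁ hz₁)
    have hv := hRS.sub_mem_of_inner_pos (cΔ hu) (ncΔ h₁) (ne_of_zero hpos hz₁) hlt
    have hw := hRS.sub_mem_of_inner_pos (cΔ hu) hsum (ne_of_zero hpos hz)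
      (by rw [inner_add_right]; linarith [inner_nonneg hu hpos h₂ hp₂ hz₂])
    rw [sub_eq_add_neg] at hv
    refine sub_not_mem (hCD.add_cnc u hu _ (hCD.neg_nc _ h₁) hv) ?_ h₂ hp₂ hz₂ ?_
    · rwa [inner_add_right, inner_neg_right, hz₁, neg_zero, add_zero]
    · convert hw using 1
      abel
  · refine le_antisymm (inner_nonpos hu hpos h₁ hp₁ hz₁) (not_lt.1 fun hlt => ?_)
    have hv := hRS.add_mem_of_inner_neg (ncΔ hu) (ncΔ h₁)
      (ne_of_zero hpos (by rw [inner_neg_right, hz₁, neg_zero])) hlt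
    have hw := hRS.add_mem_of_inner_neg (ncΔ hu) hsum
      (ne_of_zero hpos (by rw [inner_neg_right, hz, neg_zero]))
      (by rw [inner_add_right]; linarith [inner_nonpos hu hpos h₂ hp₂ hz₂])
    refine add_not_mem (hCD.add_ncnc u hu _ h₁ hv) ?_ h₂ hp₂ hz₂ (by rwa [add_assoc])
    rwa [inner_add_right, hz₁, add_zero]
end

section
/- Let λ ∈ V satisfy (λ,α) ≥ 0 for all α ∈ Δ₊^c and (λ,β) ≤ 0 for all β ∈ Δ₊^nc. If β ∈ Δ₊^nc satisfies (λ,β) < 0, then for every β' ∈ Δ₊^nc the sum β + β' is not a root. -/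
open scoped RealInnerProductSpace

/-- If `(λ,β) < 0` for a positive noncompact root `β`, then `β + β'` is not a root
for any positive noncompact root `β'`. -/
theorem strictly_negative_noncompact_add_not_root {V : Type*} [NormedAddCommGroup V]
    [InnerProductSpace ℝ V] [FiniteDimensional ℝ V] (Δ Δc Δnc Δp : Set V)
    (hRS : IsRootSystem Δ) (hCD : IsCompactDecomp Δ Δc Δnc) (hPS : IsPositiveSystem Δ Δp)
    (lam : V)
    (h1 : ∀ α ∈ Δc ∩ Δp, 0 ≤ ⟪lam, α⟫)
    (h2 : ∀ β ∈ Δnc ∩ Δp, ⟪lam, β⟫ ≤ 0)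
    (β : V) (hβ : β ∈ Δnc ∩ Δp) (hneg : ⟪lam, β⟫ < 0) :
    ∀ β' ∈ Δnc ∩ Δp, β + β' ∉ Δ := by
  rintro β' hβ' hsum
  have hnonneg := h1 (β + β') ⟨hCD.add_ncnc β hβ.1 β' hβ'.1 hsum, hPS.add_mem β hβ.2 β' hβ'.2 hsum⟩
  rw [inner_add_right] at hnonneg
  linarith [h2 β' hβ']
end

section
/- Let 𝔤 be a finite-dimensional complex simple Lie algebra with Cartan subalgebra 𝔥, root system Δ ⊆ 𝔥* and root space decomposition 𝔤 = 𝔥 ⊕ ⨁_{α∈Δ} 𝔤_α. Suppose 𝔤 = 𝔨 ⊕ 𝔭 where 𝔨, 𝔭 are complex subspaces with 𝔥 ⊆ 𝔨, ⁅𝔨,𝔨⁆ ⊆ 𝔨, ⁅𝔨,𝔭⁆ ⊆ 𝔭, ⁅𝔭,𝔭⁆ ⊆ 𝔨 (so each root space lies in 𝔨 or in 𝔭, giving a partition Δ = Δ^c ⊔ Δ^nc). Fix a set of positive roots Δ₊, set Δ₊^c = Δ^c ∩ Δ₊, Δ₊^nc = Δ^nc ∩ Δ₊, and let λ lie in the real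 span of Δ with (λ,α) ≥ 0 for all α ∈ Δ₊^c and (λ,β) ≤ 0 for all β ∈ Δ₊^nc, where (·,·) is the inner product induced by the Killing form. Define Δ₊^{nc,1} := {β ∈ Δ₊^nc : (λ,β) < 0}, Δ₊^{nc,2} := {β ∈ Δ₊^nc : (λ,β) = 0 and β = α + β' for some α ∈ Δ₊^c, β' ∈ Δ₊^{nc,1}}, and set 𝔍₋ := ⨁_{β ∈ Δ₊^{nc,1}∪Δ₊^{nc,2}} 𝔤_β, 𝔍₊ := ⨁_{β ∈ Δ₊^{nc,1}∪Δ₊^{nc,2}} 𝔤_{−β}, 𝔍₀ := ⁅𝔍₊,𝔍₋⁆. Then 𝔍 := 𝔍₊ ⊕ 𝔍₀ ⊕ 𝔍₋ is a Lie ideal of 𝔤. -/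
open scoped RealInnerProductSpace

/-- A root space decomposition of a complex Lie algebra `L` relative to a Cartan
subalgebra `H`, with roots realized in the real inner product space `V` (the real span
of the roots with the inner product induced by the Killing form). -/
structure RootDecomposition {V : Type*} [NormedAddCommGroup V] [InnerProductSpace ℝ V]
    [FiniteDimensional ℝ V] (Δ : Set V)
    (L : Type*) [LieRing L] [LieAlgebra ℂ L] where
  /-- the Cartan subalgebra `𝔥` -/
  H : LieSubalgebra ℂ L
  isCartan : H.IsCartanSubalgebra
  /-- the root space `𝔤_α` -/
  rootSpace : V → Submodule ℂ L
  rootSpace_finrank : ∀ α ∈ Δ, Module.finrank ℂ (rootSpace α) = 1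
  sup_eq_top : H.toSubmodule ⊔ (⨆ α ∈ Δ, rootSpace α) = ⊤
  indep_H : Disjoint H.toSubmodule (⨆ α ∈ Δ, rootSpace α)
  indep_roots : iSupIndep fun α : Δ => rootSpace (α : V)
  bracket_H_root : ∀ α ∈ Δ, ∀ h ∈ H, ∀ x ∈ rootSpace α, ⁅h, x⁆ ∈ rootSpace α
  bracket_root_root : ∀ α ∈ Δ, ∀ β ∈ Δ, α + β ∈ Δ →
    ∀ x ∈ rootSpace α, ∀ y ∈ rootSpace β, ⁅x, y⁆ ∈ rootSpace (α + β)
  bracket_neg : ∀ α ∈ Δ, ∀ x ∈ rootSpace α, ∀ y ∈ rootSpace (-α), ⁅x, y⁆ ∈ H.toSubmodule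
  bracket_not_root : ∀ α ∈ Δ, ∀ β ∈ Δ, α + β ∉ Δ → α + β ≠ 0 →
    ∀ x ∈ rootSpace α, ∀ y ∈ rootSpace β, ⁅x, y⁆ = 0

namespace LieAlgebra.IsKilling

open LieModule

variable {K L : Type*} [Field K] [CharZero K] [LieRing L] [LieAlgebra K L] [IsKilling K L]
  [FiniteDimensional K L] {H : LieSubalgebra K L} [H.IsCartanSubalgebra] [IsTriangularizable K H L]

/-- The bracket of nonzero root vectors is nonzero if the sum of the roots is a weight. -/
lemma lie_ne_zero_of_mem_rootSpace {α β : Weight K H L} (hα : α.IsNonZero) (hβ : β.IsNonZero)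
    (hαβ : rootSpace H (α + β : H → K) ≠ ⊥) {x y : L} (hx : x ∈ rootSpace H α)
    (hy : y ∈ rootSpace H β) (hx0 : x ≠ 0) (hy0 : y ≠ 0) : ⁅x, y⁆ ≠ 0 := by
  have hα' : (-α).IsNonZero := Weight.isNonZero_neg.mpr hα
  obtain ⟨v, hv, v_ne⟩ := (chainTop (-α) β).exists_ne_zero
  obtain ⟨h, e, f, isSl2, he, hf⟩ := exists_isSl2Triple_of_weight_isNonZero hα'
  obtain rfl := isSl2.h_eq_coroot hα' he hf
  have prim : isSl2.HasPrimitiveVectorWith v (chainLength (-α) β : K) := by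
    have := lie_mem_genWeightSpace_of_mem_genWeightSpace he hv
    exact ⟨v_ne, (chainLength_smul _ _ hv).symm,
      by rwa [genWeightSpace_add_chainTop _ _ hα'] at this⟩
  have hbot : (1 : ℤ) ≤ chainBotCoeff (-α) β :=
    le_chainBotCoeff_of_rootSpace_ne_top (-α) β hα' 1 (by simpa using hαβ)
  have hlen : chainTopCoeff (-α) β + 1 ≤ chainLength (-α) β := by
    have := chainTopCoeff_add_chainBotCoeff (-α) β
    simp only [Weight.coe_neg] at *
    lia
  set n := chainTopCoeff (-α) β
  set w := (toEnd K L L f ^ n) v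
  have hw : w ∈ rootSpace H β := by
    have := toEnd_pow_apply_mem hf hv n
    rw [coe_chainTop'] at this
    convert this using 2
    simp [n]
  have hw0 : w ≠ 0 := prim.pow_toEnd_f_ne_zero_of_eq_nat rfl (by lia)
  have hfw : ⁅f, w⁆ ≠ 0 := by
    have := prim.pow_toEnd_f_ne_zero_of_eq_nat rfl hlen
    rwa [pow_succ'] at this
  have hf : f ∈ rootSpace H α := by simpa using hf
  obtain ⟨c, hc⟩ : ∃ c : K, c • x = f := by
    simpa using (finrank_eq_one_iff_of_nonzero' ⟨x, hx⟩ (by simpa using hx0)).mp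
      (finrank_rootSpace_eq_one α hα) ⟨f, hf⟩
  obtain ⟨d, hd⟩ : ∃ d : K, d • y = w := by
    simpa using (finrank_eq_one_iff_of_nonzero' ⟨y, hy⟩ (by simpa using hy0)).mp
      (finrank_rootSpace_eq_one β hβ) ⟨w, hw⟩
  rintro hxy
  exact hfw (by rw [← hc, ← hd, smul_lie, lie_smul, hxy, smul_zero, smul_zero])

/-- Every nonzero element of a root space has a nonzero bracket with some vector of the
opposite root space. -/
lemma exists_lie_ne_zero_of_mem_rootSpace {α : Weight K H L} (hα : α.IsNonZero) :
    ∃ x ∈ rootSpace H α, ∃ y ∈ rootSpace H (-α), ⁅x, y⁆ ≠ 0 := by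
  obtain ⟨h, e, f, t, he, hf⟩ := exists_isSl2Triple_of_weight_isNonZero hα
  exact ⟨e, he, f, hf, by rw [t.lie_e_f]; exact t.h_ne_zero⟩

end LieAlgebra.IsKilling

lemma IsRootSystem.neg_mem_s10 {V : Type*} [NormedAddCommGroup V] [InnerProductSpace ℝ V]
    [FiniteDimensional ℝ V] {Δ : Set V} (hRS : IsRootSystem Δ) {α : V} (hα : α ∈ Δ) : -α ∈ Δ := by
  have h0 : α ≠ 0 := fun h ↦ hRS.zero_not_mem (h ▸ hα)
  have := hRS.reflection_mem α hα α hα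
  rw [mul_div_assoc, div_self (inner_self_ne_zero.mpr h0), mul_one, two_smul] at this
  simpa using this

namespace RootDecomposition

open LieAlgebra LieModule

variable {V : Type*} [NormedAddCommGroup V] [InnerProductSpace ℝ V] [FiniteDimensional ℝ V]
  {Δ : Set V} {L : Type*} [LieRing L] [LieAlgebra ℂ L] (D : RootDecomposition Δ L)

instance : D.H.IsCartanSubalgebra := D.isCartan

lemma exists_ne_zero {α : V} (hα : α ∈ Δ) : ∃ x ∈ D.rootSpace α, x ≠ 0 := by
  obtain ⟨x, hx, -⟩ := finrank_eq_one_iff'.mp (D.rootSpace_finrank α hα)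
  exact ⟨x, x.2, by simpa using hx⟩

lemma exists_smul_eq {α : V} (hα : α ∈ Δ) {x y : L} (hx : x ∈ D.rootSpace α) (hx0 : x ≠ 0)
    (hy : y ∈ D.rootSpace α) : ∃ c : ℂ, c • x = y := by
  simpa using (finrank_eq_one_iff_of_nonzero' ⟨x, hx⟩ (by simpa using hx0)).mp
      (D.rootSpace_finrank α hα) ⟨y, hy⟩

lemma eq_zero_of_mem_H {α : V} (hα : α ∈ Δ) {x : L} (hx : x ∈ D.rootSpace α)
    (hxH : x ∈ D.H) : x = 0 :=
  Submodule.disjoint_def.mp D.indep_H x hxH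
    (Submodule.mem_iSup_of_mem α (Submodule.mem_iSup_of_mem hα hx))

/-- Some bracket of vectors of the two given root spaces is nonzero. -/
def Linked (α β : V) : Prop := ∃ x ∈ D.rootSpace α, ∃ y ∈ D.rootSpace β, ⁅x, y⁆ ≠ 0

variable {D} in
lemma Linked.add_eq_zero_or_mem {α β : V} (hα : α ∈ Δ) (hβ : β ∈ Δ) (h : D.Linked α β) :
    α + β = 0 ∨ α + β ∈ Δ := by
  obtain ⟨x, hx, y, hy, hxy⟩ := h
  by_contra! hc
  exact hxy (D.bracket_not_root α hα β hβ hc.2 hc.1 x hx y hy)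

/-- Every root space of the decomposition is a root space in the sense of weights. -/
lemma exists_weight [FiniteDimensional ℂ L] [IsKilling ℂ L] {α : V} (hα : α ∈ Δ) :
    ∃ χ : Weight ℂ D.H L, χ.IsNonZero ∧
      D.rootSpace α = (LieAlgebra.rootSpace D.H χ).toSubmodule := by
  obtain ⟨e, he, he0⟩ := D.exists_ne_zero hα
  choose χ hχ using fun h : D.H ↦
    D.exists_smul_eq hα he he0 (D.bracket_H_root α hα h h.2 e he)
  have hmem : e ∈ LieAlgebra.rootSpace D.H χ := by
    rw [mem_genWeightSpace]
    exact fun h ↦ ⟨1, by simp [hχ]⟩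
  let W : Weight ℂ D.H L := ⟨χ, fun hb ↦ he0 (by simpa [hb] using hmem)⟩
  have hW : W.IsNonZero := by
    intro h0
    have h0 : χ = 0 := h0
    rw [h0, rootSpace_zero_eq] at hmem
    exact he0 (D.eq_zero_of_mem_H hα he hmem)
  refine ⟨W, hW, Submodule.eq_of_le_of_finrank_eq (fun x hx ↦ ?_) ?_⟩
  · obtain ⟨c, rfl⟩ := D.exists_smul_eq hα he he0 hx
    exact Submodule.smul_mem _ c hmem
  · rw [D.rootSpace_finrank α hα]
    exact (IsKilling.finrank_rootSpace_eq_one W hW).symm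

/-- Every weight with a nonzero weight space is the weight of some root of the decomposition. -/
lemma exists_mem_of_weight [FiniteDimensional ℂ L] [IsKilling ℂ L] {χ : Weight ℂ D.H L}
    (hχ : χ.IsNonZero) :
    ∃ α ∈ Δ, D.rootSpace α = (LieAlgebra.rootSpace D.H χ).toSubmodule := by
  by_contra! hc
  have hle : (⊤ : LieSubmodule ℂ D.H L) ≤
      ⨆ (ψ : D.H → ℂ) (_ : ψ ≠ χ), LieAlgebra.rootSpace D.H ψ := by
    rw [← LieSubmodule.toSubmodule_le_toSubmodule, LieSubmodule.top_toSubmodule, ← D.sup_eq_top,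
      sup_le_iff, iSup₂_le_iff]
    constructor
    · rw [← D.H.coe_toLieSubmodule, ← rootSpace_zero_eq, LieSubmodule.toSubmodule_le_toSubmodule]
      exact le_iSup₂_of_le 0 (fun h ↦ hχ h.symm) le_rfl
    · intro α hα
      obtain ⟨ψ, -, hψ⟩ := D.exists_weight hα
      rw [hψ, LieSubmodule.toSubmodule_le_toSubmodule]
      refine le_iSup₂_of_le ψ (fun h ↦ hc α hα ?_) le_rfl
      rw [hψ, h]
  exact absurd (((iSupIndep_genWeightSpace ℂ D.H L χ).mono_right hle).eq_bot_of_le le_top)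
    χ.genWeightSpace_ne_bot

lemma rootSpace_neg [FiniteDimensional ℂ L] [IsKilling ℂ L] {α : V} (hα : α ∈ Δ)
    {χ : Weight ℂ D.H L} (hχ : χ.IsNonZero)
    (h : D.rootSpace α = (LieAlgebra.rootSpace D.H χ).toSubmodule) :
    D.rootSpace (-α) = (LieAlgebra.rootSpace D.H (-χ)).toSubmodule := by
  obtain ⟨β, hβ, hβχ⟩ := D.exists_mem_of_weight (Weight.isNonZero_neg.mpr hχ)
  obtain ⟨x, hx, y, hy, hxy⟩ := IsKilling.exists_lie_ne_zero_of_mem_rootSpace hχ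
  have hxα : x ∈ D.rootSpace α := by rw [h]; exact hx
  have hyβ : y ∈ D.rootSpace β := by rw [hβχ]; exact hy
  have hH : ⁅x, y⁆ ∈ D.H := by
    have : ⁅x, y⁆ ∈ LieAlgebra.rootSpace D.H (χ + -χ : D.H → ℂ) :=
      lie_mem_genWeightSpace_of_mem_genWeightSpace hx hy
    rwa [add_neg_cancel, rootSpace_zero_eq] at this
  have hl : D.Linked α β := ⟨x, hxα, y, hyβ, hxy⟩
  obtain h0 | hm := hl.add_eq_zero_or_mem hα hβ
  · rwa [neg_eq_of_add_eq_zero_right h0]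
  · exact absurd (D.eq_zero_of_mem_H hm (D.bracket_root_root α hα β hβ hm x hxα y hyβ) hH) hxy

lemma linked_neg_self [FiniteDimensional ℂ L] [IsKilling ℂ L] {α : V} (hα : α ∈ Δ) :
    D.Linked α (-α) := by
  obtain ⟨χ, hχ, h⟩ := D.exists_weight hα
  obtain ⟨x, hx, y, hy, hxy⟩ := IsKilling.exists_lie_ne_zero_of_mem_rootSpace hχ
  refine ⟨x, by rw [h]; exact hx, y, by rw [D.rootSpace_neg hα hχ h]; exact hy, hxy⟩

lemma linked_of_weight [FiniteDimensional ℂ L] [IsKilling ℂ L] {α β : V} (hα : α ∈ Δ)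
    (hβ : β ∈ Δ) {χ ψ φ : Weight ℂ D.H L} (hχ : χ.IsNonZero) (hψ : ψ.IsNonZero)
    (hαχ : D.rootSpace α = (LieAlgebra.rootSpace D.H χ).toSubmodule)
    (hβψ : D.rootSpace β = (LieAlgebra.rootSpace D.H ψ).toSubmodule)
    (hφ : (φ : D.H → ℂ) = χ + ψ) : D.Linked α β := by
  obtain ⟨x, hx, hx0⟩ := D.exists_ne_zero hα
  obtain ⟨y, hy, hy0⟩ := D.exists_ne_zero hβ
  refine ⟨x, hx, y, hy, IsKilling.lie_ne_zero_of_mem_rootSpace hχ hψ ?_ ?_ ?_ hx0 hy0⟩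
  · rw [← hφ]; exact φ.genWeightSpace_ne_bot
  · rwa [hαχ] at hx
  · rwa [hβψ] at hy

variable {D} in
lemma Linked.weight_add [FiniteDimensional ℂ L] [IsKilling ℂ L] {α β : V}
    (h : D.Linked α β) (hα : α ∈ Δ) (hβ : β ∈ Δ) (hαβ : α + β ∈ Δ) {χ ψ φ : Weight ℂ D.H L}
    (hαχ : D.rootSpace α = (LieAlgebra.rootSpace D.H χ).toSubmodule)
    (hβψ : D.rootSpace β = (LieAlgebra.rootSpace D.H ψ).toSubmodule)
    (hφ : D.rootSpace (α + β) = (LieAlgebra.rootSpace D.H φ).toSubmodule) :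
    (φ : D.H → ℂ) = χ + ψ := by
  obtain ⟨x, hx, y, hy, hxy⟩ := h
  have h1 := D.bracket_root_root α hα β hβ hαβ x hx y hy
  rw [hφ] at h1
  rw [hαχ] at hx
  rw [hβψ] at hy
  have h2 := lie_mem_genWeightSpace_of_mem_genWeightSpace hx hy
  by_contra hne
  have := (disjoint_genWeightSpace ℂ D.H L hne).le_bot ⟨h1, h2⟩
  exact hxy (by simpa using this)

variable {D} in
lemma Linked.neg [FiniteDimensional ℂ L] [IsKilling ℂ L] (hRS : IsRootSystem Δ) {α β : V}
    (h : D.Linked α β) (hα : α ∈ Δ) (hβ : β ∈ Δ) (hαβ : α + β ∈ Δ) : D.Linked (-α) (-β) := by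
  obtain ⟨χ, hχ, hαχ⟩ := D.exists_weight hα
  obtain ⟨ψ, hψ, hβψ⟩ := D.exists_weight hβ
  obtain ⟨φ, hφ, hφ'⟩ := D.exists_weight hαβ
  refine D.linked_of_weight (φ := -φ) (hRS.neg_mem_s10 hα) (hRS.neg_mem_s10 hβ) hχ.neg hψ.neg
    (D.rootSpace_neg hα hχ hαχ) (D.rootSpace_neg hβ hψ hβψ) ?_
  rw [Weight.coe_neg, h.weight_add hα hβ hαβ hαχ hβψ hφ', neg_add, Weight.coe_neg, Weight.coe_neg]

variable {D} in
lemma Linked.neg_add_left [FiniteDimensional ℂ L] [IsKilling ℂ L] (hRS : IsRootSystem Δ) {α β : V}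
    (h : D.Linked α β) (hα : α ∈ Δ) (hβ : β ∈ Δ) (hαβ : α + β ∈ Δ) :
    D.Linked (-(α + β)) β := by
  obtain ⟨χ, hχ, hαχ⟩ := D.exists_weight hα
  obtain ⟨ψ, hψ, hβψ⟩ := D.exists_weight hβ
  obtain ⟨φ, hφ, hφ'⟩ := D.exists_weight hαβ
  refine D.linked_of_weight (φ := -χ) (hRS.neg_mem_s10 hαβ) hβ hφ.neg hψ
    (D.rootSpace_neg hαβ hφ hφ') hβψ ?_
  rw [Weight.coe_neg, Weight.coe_neg, h.weight_add hα hβ hαβ hαχ hβψ hφ']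
  abel

lemma lie_eq_zero_or {α β : V} (hα : α ∈ Δ) (hβ : β ∈ Δ) {x y : L} (hx : x ∈ D.rootSpace α)
    (hy : y ∈ D.rootSpace β) :
    ⁅x, y⁆ = 0 ∨ α + β = 0 ∨ (D.Linked α β ∧ α + β ∈ Δ ∧ ⁅x, y⁆ ∈ D.rootSpace (α + β)) := by
  by_cases hxy : ⁅x, y⁆ = 0
  · exact .inl hxy
  have hl : D.Linked α β := ⟨x, hx, y, hy, hxy⟩
  exact .inr ((hl.add_eq_zero_or_mem hα hβ).imp_right fun h ↦
    ⟨hl, h, D.bracket_root_root α hα β hβ h x hx y hy⟩)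

variable {D} in
/-- If `⁅𝔤_α, 𝔤_β⁆` is nonzero, it is all of the root space of `α + β`. -/
lemma Linked.exists_lie_eq {α β : V} (h : D.Linked α β) (hα : α ∈ Δ) (hβ : β ∈ Δ)
    (hαβ : α + β ∈ Δ) {z : L} (hz : z ∈ D.rootSpace (α + β)) :
    ∃ x ∈ D.rootSpace α, ∃ y ∈ D.rootSpace β, z = ⁅x, y⁆ := by
  obtain ⟨x, hx, y, hy, hxy⟩ := h
  obtain ⟨c, rfl⟩ := D.exists_smul_eq hαβ (D.bracket_root_root α hα β hβ hαβ x hx y hy) hxy hz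
  exact ⟨c • x, Submodule.smul_mem _ c hx, y, hy, (smul_lie c x y).symm⟩

/-- The sum of the root spaces of the roots in `S`. -/
def sumRootSpaces (S : Set V) : Submodule ℂ L := ⨆ β ∈ S, D.rootSpace β

variable {D} in
lemma mem_sumRootSpaces {S : Set V} {β : V} (hβ : β ∈ S) {x : L} (hx : x ∈ D.rootSpace β) :
    x ∈ D.sumRootSpaces S :=
  Submodule.mem_iSup_of_mem β (Submodule.mem_iSup_of_mem hβ hx)

lemma sumRootSpaces_le {S : Set V} {U : Submodule ℂ L} :
    D.sumRootSpaces S ≤ U ↔ ∀ β ∈ S, ∀ x ∈ D.rootSpace β, x ∈ U :=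
  iSup₂_le_iff

/-- The elements `x` such that `ad x` maps the subspace `U` into itself. -/
def _root_.Submodule.lieStabilizer (U : Submodule ℂ L) : Submodule ℂ L where
  carrier := {x | ∀ y ∈ U, ⁅x, y⁆ ∈ U}
  add_mem' hx hy z hz := by rw [add_lie]; exact add_mem (hx z hz) (hy z hz)
  zero_mem' z _ := by simp
  smul_mem' c x hx z hz := by rw [smul_lie]; exact U.smul_mem c (hx z hz)

lemma _root_.Submodule.mem_lieStabilizer_sup {U W : Submodule ℂ L} {x : L}
    (hU : x ∈ U.lieStabilizer) (hW : x ∈ W.lieStabilizer) : x ∈ (U ⊔ W).lieStabilizer := by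
  intro y hy
  obtain ⟨u, hu, w, hw, rfl⟩ := Submodule.mem_sup.mp hy
  rw [lie_add]
  exact add_mem (Submodule.mem_sup_left (hU u hu)) (Submodule.mem_sup_right (hW w hw))

lemma lie_mem_of_forall {S : Set V} {U : Submodule ℂ L} {x : L}
    (h : ∀ β ∈ S, ∀ y ∈ D.rootSpace β, ⁅x, y⁆ ∈ U) : ∀ y ∈ D.sumRootSpaces S, ⁅x, y⁆ ∈ U :=
  D.sumRootSpaces_le (U := U.comap (LieModule.toEnd ℂ L L x)).mpr h

lemma H_le_lieStabilizer {S : Set V} (hS : S ⊆ Δ) :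
    D.H.toSubmodule ≤ (D.sumRootSpaces S).lieStabilizer := fun x hx ↦
  D.lie_mem_of_forall fun β hβ y hy ↦
    mem_sumRootSpaces hβ (D.bracket_H_root β (hS hβ) x hx y hy)

/-- The roots of the subspace `𝔍₋`, for the partition `C ∪ N` of the roots into compact and
noncompact ones. -/
def idealRoots (C N : Set V) (lam : V) : Set V :=
  {β | β ∈ N ∧ (⟪lam, β⟫ < 0 ∨ (⟪lam, β⟫ = 0 ∧
    ∃ α ∈ C, ∃ γ ∈ N, ⟪lam, γ⟫ < 0 ∧ α + γ = β ∧ D.Linked α γ))}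

/-- The span of the brackets of the elements of `𝔍₊` and `𝔍₋`. -/
def sumBrackets (C N : Set V) (lam : V) : Submodule ℂ L :=
  Submodule.span ℂ {z : L | ∃ x ∈ D.sumRootSpaces (-D.idealRoots C N lam),
    ∃ y ∈ D.sumRootSpaces (D.idealRoots C N lam), z = ⁅x, y⁆}

/-- A partition of the roots into compact roots `C` and noncompact roots `N`, compatible with the
bracket, and a vector `lam` that is dominant for `C` and antidominant for `N`. -/
structure IsCompatible (C N Δp : Set V) (lam : V) : Prop where
  isRootSystem : IsRootSystem Δ
  isPositiveSystem : IsPositiveSystem Δ Δp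
  subset_left : C ⊆ Δ
  subset_right : N ⊆ Δ
  mem_or_mem : ∀ α ∈ Δ, α ∈ C ∨ α ∈ N
  notMem : ∀ α ∈ C, α ∉ N
  neg_mem_left : ∀ α ∈ C, -α ∈ C
  neg_mem_right : ∀ α ∈ N, -α ∈ N
  add_mem_of_left_left : ∀ α ∈ C, ∀ β ∈ C, D.Linked α β → α + β ∈ Δ → α + β ∈ C
  add_mem_of_left_right : ∀ α ∈ C, ∀ β ∈ N, D.Linked α β → α + β ∈ Δ → α + β ∈ N
  add_mem_of_right_right : ∀ α ∈ N, ∀ β ∈ N, D.Linked α β → α + β ∈ Δ → α + β ∈ C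
  inner_nonneg : ∀ α ∈ C, α ∈ Δp → 0 ≤ ⟪lam, α⟫
  inner_nonpos : ∀ β ∈ N, β ∈ Δp → ⟪lam, β⟫ ≤ 0

namespace IsCompatible

variable {D} {C N Δp : Set V} {lam : V}

/-- Reversing the positive system. -/
lemma neg (h : D.IsCompatible C N Δp lam) : D.IsCompatible C N (-Δp) (-lam) where
  __ := h
  isPositiveSystem :=
    { subset := fun α hα ↦ by
        simpa using h.isRootSystem.neg_mem_s10 (h.isPositiveSystem.subset hα)
      mem_or_neg_mem := fun α hα ↦ by
        simpa using (h.isPositiveSystem.mem_or_neg_mem α hα).symm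
      neg_not_mem := fun α hα ↦ h.isPositiveSystem.neg_not_mem _ hα
      add_mem := fun α hα β hβ hαβ ↦ by
        have := h.isPositiveSystem.add_mem _ hα _ hβ
          (by simpa [add_comm] using h.isRootSystem.neg_mem_s10 hαβ)
        simpa [add_comm] using this }
  inner_nonneg α hα hp := by
    simpa using h.inner_nonneg _ (h.neg_mem_left α hα) hp
  inner_nonpos α hα hp := by
    simpa using h.inner_nonpos _ (h.neg_mem_right α hα) hp

lemma pos_of_inner_pos (h : D.IsCompatible C N Δp lam) {α : V} (hα : α ∈ C)
    (hpos : 0 < ⟪lam, α⟫) : α ∈ Δp := by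
  refine (h.isPositiveSystem.mem_or_neg_mem α (h.subset_left hα)).resolve_right fun hn ↦ ?_
  have := h.inner_nonneg _ (h.neg_mem_left α hα) hn
  rw [inner_neg_right] at this
  linarith

lemma pos_of_inner_neg (h : D.IsCompatible C N Δp lam) {β : V} (hβ : β ∈ N)
    (hneg : ⟪lam, β⟫ < 0) : β ∈ Δp := by
  refine (h.isPositiveSystem.mem_or_neg_mem β (h.subset_right hβ)).resolve_right fun hn ↦ ?_
  have := h.inner_nonpos _ (h.neg_mem_right β hβ) hn
  rw [inner_neg_right] at this
  linarith

lemma idealRoots_subset_pos (h : D.IsCompatible C N Δp lam) : D.idealRoots C N lam ⊆ Δp := by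
  rintro β ⟨hβ, hneg | ⟨h0, α, hα, γ, hγ, hγ0, rfl, -⟩⟩
  · exact h.pos_of_inner_neg hβ hneg
  · rw [inner_add_right] at h0
    exact h.isPositiveSystem.add_mem _ (h.pos_of_inner_pos hα (by linarith)) _
      (h.pos_of_inner_neg hγ hγ0) (h.subset_right hβ)

lemma neg_idealRoots_subset (h : D.IsCompatible C N Δp lam) [FiniteDimensional ℂ L]
    [IsKilling ℂ L] : -D.idealRoots C N lam ⊆ D.idealRoots C N (-lam) := by
  rintro β ⟨hβ, hβ'⟩
  refine ⟨by simpa using h.neg_mem_right _ hβ, ?_⟩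
  obtain hneg | ⟨h0, α, hα, γ, hγ, hγ0, hsum, hl⟩ := hβ'
  · left
    simpa using hneg
  · refine .inr ⟨by simpa using h0, -α, h.neg_mem_left α hα, -γ, h.neg_mem_right γ hγ,
      by simpa using hγ0, ?_, ?_⟩
    · rw [← neg_add, hsum, neg_neg]
    · exact hl.neg h.isRootSystem (h.subset_left hα) (h.subset_right hγ)
        (hsum ▸ h.subset_right hβ)

lemma idealRoots_neg (h : D.IsCompatible C N Δp lam) [FiniteDimensional ℂ L]
    [IsKilling ℂ L] : D.idealRoots C N (-lam) = -D.idealRoots C N lam := by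
  refine subset_antisymm (fun β hβ ↦ ?_) h.neg_idealRoots_subset
  have := h.neg.neg_idealRoots_subset (a := -β) (by simpa using hβ)
  simpa using this

lemma lie_left_left (h : D.IsCompatible C N Δp lam) {α β : V} (hα : α ∈ C) (hβ : β ∈ C) {x y : L}
    (hx : x ∈ D.rootSpace α) (hy : y ∈ D.rootSpace β) :
    ⁅x, y⁆ = 0 ∨ α + β = 0 ∨ (α + β ∈ C ∧ ⁅x, y⁆ ∈ D.rootSpace (α + β)) :=
  (D.lie_eq_zero_or (h.subset_left hα) (h.subset_left hβ) hx hy).imp_right fun h1 ↦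
    h1.imp_right fun ⟨hl, hm, hxy⟩ ↦ ⟨h.add_mem_of_left_left α hα β hβ hl hm, hxy⟩

lemma lie_left_right (h : D.IsCompatible C N Δp lam) {α β : V} (hα : α ∈ C) (hβ : β ∈ N) {x y : L}
    (hx : x ∈ D.rootSpace α) (hy : y ∈ D.rootSpace β) :
    ⁅x, y⁆ = 0 ∨ (D.Linked α β ∧ α + β ∈ N ∧ ⁅x, y⁆ ∈ D.rootSpace (α + β)) := by
  refine (D.lie_eq_zero_or (h.subset_left hα) (h.subset_right hβ) hx hy).imp_right fun h1 ↦ ?_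
  obtain h0 | ⟨hl, hm, hxy⟩ := h1
  · refine absurd (h.neg_mem_right β hβ) (h.notMem _ ?_)
    rwa [neg_eq_of_add_eq_zero_left h0]
  · exact ⟨hl, h.add_mem_of_left_right α hα β hβ hl hm, hxy⟩

lemma lie_right_left (h : D.IsCompatible C N Δp lam) {α β : V} (hα : α ∈ N) (hβ : β ∈ C) {x y : L}
    (hx : x ∈ D.rootSpace α) (hy : y ∈ D.rootSpace β) :
    ⁅x, y⁆ = 0 ∨ (α + β ∈ N ∧ ⁅x, y⁆ ∈ D.rootSpace (α + β)) := by
  rw [← lie_skew, neg_eq_zero, neg_mem_iff, add_comm]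
  exact (h.lie_left_right hβ hα hy hx).imp_right And.right

lemma lie_right_right (h : D.IsCompatible C N Δp lam) {α β : V} (hα : α ∈ N) (hβ : β ∈ N) {x y : L}
    (hx : x ∈ D.rootSpace α) (hy : y ∈ D.rootSpace β) :
    ⁅x, y⁆ = 0 ∨ α + β = 0 ∨ (D.Linked α β ∧ α + β ∈ C ∧ ⁅x, y⁆ ∈ D.rootSpace (α + β)) :=
  (D.lie_eq_zero_or (h.subset_right hα) (h.subset_right hβ) hx hy).imp_right fun h1 ↦
    h1.imp_right fun ⟨hl, hm, hxy⟩ ↦ ⟨hl, h.add_mem_of_right_right α hα β hβ hl hm, hxy⟩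

lemma lie_mem_of_inner_neg (h : D.IsCompatible C N Δp lam) {α β : V} (hα : α ∈ C) (hβ : β ∈ N)
    (hneg : ⟪lam, β⟫ < 0) {x y : L} (hx : x ∈ D.rootSpace α) (hy : y ∈ D.rootSpace β) :
    ⁅x, y⁆ ∈ D.sumRootSpaces (D.idealRoots C N lam) := by
  obtain h0 | ⟨hl, hm, hxy⟩ := h.lie_left_right hα hβ hx hy
  · simp [h0]
  refine mem_sumRootSpaces (S := D.idealRoots C N lam) ⟨hm, ?_⟩ hxy
  obtain hlt | heq | hgt := lt_trichotomy ⟪lam, α + β⟫ 0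
  · exact .inl hlt
  · exact .inr ⟨heq, α, hα, β, hβ, hneg, rfl, hl⟩
  · have hα0 : 0 < ⟪lam, α⟫ := by rw [inner_add_right] at hgt; linarith
    have := h.inner_nonpos _ hm (h.isPositiveSystem.add_mem _ (h.pos_of_inner_pos hα hα0) _
      (h.pos_of_inner_neg hβ hneg) (h.subset_right hm))
    linarith

lemma lie_mem_of_mem_idealRoots (h : D.IsCompatible C N Δp lam) {α β : V} (hα : α ∈ C)
    (hβ : β ∈ D.idealRoots C N lam) {x y : L} (hx : x ∈ D.rootSpace α)
    (hy : y ∈ D.rootSpace β) : ⁅x, y⁆ ∈ D.sumRootSpaces (D.idealRoots C N lam) := by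
  have hβp := h.idealRoots_subset_pos hβ
  obtain ⟨hβN, hneg | ⟨h0, α', hα', γ, hγ, hγ0, rfl, hl⟩⟩ := hβ
  · exact h.lie_mem_of_inner_neg hα hβN hneg hx hy
  obtain hlt | heq | hgt := lt_trichotomy ⟪lam, α⟫ 0
  · obtain hz | ⟨-, hm, hxy⟩ := h.lie_left_right hα hβN hx hy
    · simp [hz]
    · exact mem_sumRootSpaces (S := D.idealRoots C N lam)
        ⟨hm, .inl (by rw [inner_add_right]; linarith)⟩ hxy
  · obtain ⟨a, ha, c, hc, rfl⟩ :=
      hl.exists_lie_eq (h.subset_left hα') (h.subset_right hγ) (h.subset_right hβN) hy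
    rw [inner_add_right] at h0
    rw [leibniz_lie]
    refine add_mem ?_ ?_
    · obtain hz | hz | ⟨hm, hxa⟩ := h.lie_left_left hα hα' hx ha
      · simp [hz]
      · have := congrArg (⟪lam, ·⟫) hz
        simp only [inner_add_right, inner_zero_right] at this
        linarith
      · exact h.lie_mem_of_inner_neg hm hγ hγ0 hxa hc
    · obtain hz | ⟨-, hm, hxc⟩ := h.lie_left_right hα hγ hx hc
      · simp [hz]
      · exact h.lie_mem_of_inner_neg hα' hm (by rw [inner_add_right]; linarith) ha hxc
  · obtain hz | ⟨-, hm, -⟩ := h.lie_left_right hα hβN hx hy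
    · simp [hz]
    · have := h.inner_nonpos _ hm (h.isPositiveSystem.add_mem _ (h.pos_of_inner_pos hα hgt) _
        hβp (h.subset_right hm))
      rw [inner_add_right] at this
      linarith

lemma lie_eq_zero_of_pos (h : D.IsCompatible C N Δp lam) {β γ : V} (hβ : β ∈ N) (hγ : γ ∈ N)
    (hβp : β ∈ Δp) (hγp : γ ∈ Δp) (hneg : ⟪lam, β⟫ + ⟪lam, γ⟫ < 0) {x y : L}
    (hx : x ∈ D.rootSpace β) (hy : y ∈ D.rootSpace γ) : ⁅x, y⁆ = 0 := by
  obtain hz | hz | ⟨-, hm, -⟩ := h.lie_right_right hβ hγ hx hy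
  · exact hz
  · exact absurd (neg_eq_of_add_eq_zero_right hz ▸ hγp) (h.isPositiveSystem.neg_not_mem β hβp)
  · have := h.inner_nonneg _ hm (h.isPositiveSystem.add_mem _ hβp _ hγp (h.subset_left hm))
    rw [inner_add_right] at this
    linarith

lemma inner_nonpos_of_mem_idealRoots {β : V} (hβ : β ∈ D.idealRoots C N lam) : ⟪lam, β⟫ ≤ 0 :=
  hβ.2.elim le_of_lt fun h ↦ h.1.le

lemma lie_eq_zero_of_mem_idealRoots (h : D.IsCompatible C N Δp lam) {β γ : V}
    (hβ : β ∈ D.idealRoots C N lam) (hγ : γ ∈ D.idealRoots C N lam) {x y : L}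
    (hx : x ∈ D.rootSpace β) (hy : y ∈ D.rootSpace γ) : ⁅x, y⁆ = 0 := by
  have hβp := h.idealRoots_subset_pos hβ
  have hγp := h.idealRoots_subset_pos hγ
  have hβ0 := inner_nonpos_of_mem_idealRoots hβ
  obtain ⟨hγN, hneg | ⟨h0, α, hα, δ, hδ, hδ0, rfl, hl⟩⟩ := hγ
  · exact h.lie_eq_zero_of_pos hβ.1 hγN hβp hγp (by linarith) hx hy
  obtain hlt | heq := hβ0.lt_or_eq
  · exact h.lie_eq_zero_of_pos hβ.1 hγN hβp hγp (by linarith) hx hy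
  obtain ⟨a, ha, d, hd, rfl⟩ :=
    hl.exists_lie_eq (h.subset_left hα) (h.subset_right hδ) (h.subset_right hγN) hy
  rw [inner_add_right] at h0
  have hα0 : 0 < ⟪lam, α⟫ := by linarith
  have hxa : ⁅x, a⁆ = 0 := by
    refine (h.lie_right_left hβ.1 hα hx ha).resolve_right fun ⟨hm, _⟩ ↦ ?_
    have := h.inner_nonpos _ hm (h.isPositiveSystem.add_mem _ hβp _ (h.pos_of_inner_pos hα hα0)
      (h.subset_right hm))
    rw [inner_add_right] at this
    linarith
  have hxd : ⁅x, d⁆ = 0 :=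
    h.lie_eq_zero_of_pos hβ.1 hδ hβp (h.pos_of_inner_neg hδ hδ0) (by linarith) hx hd
  rw [leibniz_lie, hxa, hxd, zero_lie, lie_zero, add_zero]

lemma mem_idealRoots_of_inner_neg {β : V} (hβ : β ∈ N) (hneg : ⟪lam, β⟫ < 0) :
    β ∈ D.idealRoots C N lam :=
  ⟨hβ, .inl hneg⟩

lemma lie_mem_sumBrackets_of_mem {β γ : V} (hβ : β ∈ -D.idealRoots C N lam)
    (hγ : γ ∈ D.idealRoots C N lam) {x y : L} (hx : x ∈ D.rootSpace β)
    (hy : y ∈ D.rootSpace γ) : ⁅x, y⁆ ∈ D.sumBrackets C N lam :=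
  Submodule.subset_span ⟨x, mem_sumRootSpaces hβ hx, y, mem_sumRootSpaces hγ hy, rfl⟩

lemma sumBrackets_neg [FiniteDimensional ℂ L] [IsKilling ℂ L] (h : D.IsCompatible C N Δp lam) :
    D.sumBrackets C N (-lam) ≤ D.sumBrackets C N lam := by
  refine Submodule.span_le.mpr ?_
  rintro _ ⟨x, hx, y, hy, rfl⟩
  rw [h.idealRoots_neg, neg_neg] at hx
  rw [h.idealRoots_neg] at hy
  rw [SetLike.mem_coe, ← lie_skew, neg_mem_iff]
  exact Submodule.subset_span ⟨y, hy, x, hx, rfl⟩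

lemma lie_mem_sumBrackets [FiniteDimensional ℂ L] [IsKilling ℂ L]
    (h : D.IsCompatible C N Δp lam) {ν β : V} (hν : ν ∈ N) (hβ : β ∈ D.idealRoots C N lam)
    {x y : L} (hx : x ∈ D.rootSpace ν) (hy : y ∈ D.rootSpace β) :
    ⁅x, y⁆ ∈ D.sumBrackets C N lam := by
  by_cases hνS : ν ∈ D.idealRoots C N lam
  · simp [h.lie_eq_zero_of_mem_idealRoots hνS hβ hx hy]
  by_cases hνS' : ν ∈ -D.idealRoots C N lam
  · exact lie_mem_sumBrackets_of_mem hνS' hβ hx hy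
  have hν0 : ⟪lam, ν⟫ = 0 := by
    refine le_antisymm (not_lt.mp fun hlt ↦ hνS' ?_)
      (not_lt.mp fun hlt ↦ hνS (mem_idealRoots_of_inner_neg hν hlt))
    exact mem_idealRoots_of_inner_neg (h.neg_mem_right ν hν) (by simpa using hlt)
  have key : ∀ γ ∈ N, ⟪lam, γ⟫ < 0 → ∀ z ∈ D.rootSpace γ, ⁅x, z⁆ = 0 := by
    intro γ hγ hγ0 z hz
    obtain h0 | h0 | ⟨hl, hm, -⟩ := h.lie_right_right hν hγ hx hz
    · exact h0
    · have := congrArg (⟪lam, ·⟫) h0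
      simp only [inner_add_right, inner_zero_right] at this
      linarith
    · refine absurd ?_ hνS'
      exact ⟨h.neg_mem_right ν hν, .inr ⟨by simpa using hν0, -(ν + γ), h.neg_mem_left _ hm, γ, hγ,
        hγ0, by abel, hl.neg_add_left h.isRootSystem (h.subset_right hν) (h.subset_right hγ)
          (h.subset_left hm)⟩⟩
  obtain ⟨hβN, hneg | ⟨h0, α, hα, γ, hγ, hγ0, rfl, hl⟩⟩ := hβ
  · simp [key β hβN hneg y hy]
  obtain ⟨a, ha, c, hc, rfl⟩ :=
    hl.exists_lie_eq (h.subset_left hα) (h.subset_right hγ) (h.subset_right hβN) hy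
  rw [leibniz_lie, key γ hγ hγ0 c hc, lie_zero, add_zero]
  obtain hz | ⟨hm, hxa⟩ := h.lie_right_left hν hα hx ha
  · simp [hz]
  · refine lie_mem_sumBrackets_of_mem ?_ (mem_idealRoots_of_inner_neg hγ hγ0) hxa hc
    rw [inner_add_right] at h0
    exact mem_idealRoots_of_inner_neg (h.neg_mem_right _ hm)
      (by rw [inner_neg_right, inner_add_right]; linarith)

lemma lie_mem_sumBrackets_neg [FiniteDimensional ℂ L] [IsKilling ℂ L]
    (h : D.IsCompatible C N Δp lam) {ν β : V} (hν : ν ∈ N) (hβ : β ∈ -D.idealRoots C N lam)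
    {x y : L} (hx : x ∈ D.rootSpace ν) (hy : y ∈ D.rootSpace β) :
    ⁅x, y⁆ ∈ D.sumBrackets C N lam :=
  h.sumBrackets_neg (h.neg.lie_mem_sumBrackets hν (h.idealRoots_neg ▸ hβ) hx hy)

lemma rootSpace_le_lieStabilizer (h : D.IsCompatible C N Δp lam) {α : V} (hα : α ∈ C) :
    D.rootSpace α ≤ (D.sumRootSpaces (D.idealRoots C N lam)).lieStabilizer :=
  fun _ hx ↦ D.lie_mem_of_forall fun _ hβ _ hy ↦ h.lie_mem_of_mem_idealRoots hα hβ hx hy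

lemma sumBrackets_le (h : D.IsCompatible C N Δp lam) {U : Submodule ℂ L}
    (hH : D.H.toSubmodule ≤ U) (hC : ∀ α ∈ C, D.rootSpace α ≤ U) :
    D.sumBrackets C N lam ≤ U := by
  refine Submodule.span_le.mpr ?_
  rintro _ ⟨x, hx, y, hy, rfl⟩
  refine D.lie_mem_of_forall (fun γ hγ y hy ↦ ?_) y hy
  rw [← lie_skew, neg_mem_iff]
  refine D.lie_mem_of_forall (fun β hβ x hx ↦ ?_) x hx
  have hβN : β ∈ N := by simpa using h.neg_mem_right _ hβ.1
  obtain hz | hz | ⟨-, hm, hxy⟩ := h.lie_right_right hγ.1 hβN hy hx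
  · simp [hz]
  · rw [← neg_eq_of_add_eq_zero_right hz] at hx
    exact hH (D.bracket_neg γ (h.subset_right hγ.1) y hy x hx)
  · exact hC _ hm hxy

lemma lie_mem_sumBrackets_of_mem_lieStabilizer {x : L}
    (hx : x ∈ (D.sumRootSpaces (D.idealRoots C N lam)).lieStabilizer)
    (hx' : x ∈ (D.sumRootSpaces (-D.idealRoots C N lam)).lieStabilizer) :
    x ∈ (D.sumBrackets C N lam).lieStabilizer := by
  intro z hz
  induction hz using Submodule.span_induction with
  | mem z hz =>
    obtain ⟨p, hp, m, hm, rfl⟩ := hz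
    rw [leibniz_lie]
    exact add_mem (Submodule.subset_span ⟨_, hx' p hp, m, hm, rfl⟩)
      (Submodule.subset_span ⟨p, hp, _, hx m hm, rfl⟩)
  | zero => simp
  | add y z _ _ hy hz => rw [lie_add]; exact add_mem hy hz
  | smul c y _ hy => rw [lie_smul]; exact Submodule.smul_mem _ c hy

lemma lieStabilizer_eq_top [FiniteDimensional ℂ L] [IsKilling ℂ L]
    (h : D.IsCompatible C N Δp lam) :
    (D.sumRootSpaces (-D.idealRoots C N lam) ⊔ D.sumBrackets C N lam ⊔
      D.sumRootSpaces (D.idealRoots C N lam)).lieStabilizer = ⊤ := by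
  set S := D.idealRoots C N lam
  have hSΔ : S ⊆ Δ := fun β hβ ↦ h.subset_right hβ.1
  have hSΔ' : -S ⊆ Δ := fun β hβ ↦ by simpa using h.isRootSystem.neg_mem_s10 (hSΔ hβ)
  set U := (D.sumRootSpaces S).lieStabilizer ⊓ (D.sumRootSpaces (-S)).lieStabilizer
  have hH : D.H.toSubmodule ≤ U :=
    le_inf (D.H_le_lieStabilizer hSΔ) (D.H_le_lieStabilizer hSΔ')
  have hC : ∀ α ∈ C, D.rootSpace α ≤ U := fun α hα ↦
    le_inf (h.rootSpace_le_lieStabilizer hα)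
      (h.idealRoots_neg ▸ h.neg.rootSpace_le_lieStabilizer hα)
  have hUle : U ≤ (D.sumRootSpaces (-S) ⊔ D.sumBrackets C N lam ⊔
      D.sumRootSpaces S).lieStabilizer := fun x hx ↦
    Submodule.mem_lieStabilizer_sup (Submodule.mem_lieStabilizer_sup hx.2
      (lie_mem_sumBrackets_of_mem_lieStabilizer hx.1 hx.2)) hx.1
  rw [eq_top_iff, ← D.sup_eq_top, sup_le_iff, iSup₂_le_iff]
  refine ⟨hH.trans hUle, fun ν hνΔ ↦ ?_⟩
  obtain hν | hν := h.mem_or_mem ν hνΔ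
  · exact (hC ν hν).trans hUle
  intro x hx y hy
  have hm : ∀ m ∈ D.sumRootSpaces S, ⁅x, m⁆ ∈ D.sumBrackets C N lam :=
    D.lie_mem_of_forall fun β hβ y hy ↦ h.lie_mem_sumBrackets hν hβ hx hy
  have hp : ∀ p ∈ D.sumRootSpaces (-S), ⁅x, p⁆ ∈ D.sumBrackets C N lam :=
    D.lie_mem_of_forall fun β hβ y hy ↦ h.lie_mem_sumBrackets_neg hν hβ hx hy
  have hB : D.sumBrackets C N lam ≤ U := h.sumBrackets_le hH hC
  have hz : ∀ z ∈ D.sumBrackets C N lam, ⁅x, z⁆ ∈ D.sumRootSpaces (-S) ⊔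
      D.sumBrackets C N lam ⊔ D.sumRootSpaces S := by
    intro z hz
    induction hz using Submodule.span_induction with
    | mem z hz =>
      obtain ⟨p, hp', m, hm', rfl⟩ := hz
      rw [leibniz_lie]
      refine add_mem (Submodule.mem_sup_right ((hB (hp p hp')).1 m hm'))
        (Submodule.mem_sup_left (Submodule.mem_sup_left ?_))
      rw [← lie_skew, neg_mem_iff]
      exact (hB (hm m hm')).2 p hp'
    | zero => simp
    | add y z _ _ hy hz => rw [lie_add]; exact add_mem hy hz
    | smul c y _ hy => rw [lie_smul]; exact Submodule.smul_mem _ c hy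
  obtain ⟨w, hw, m, hm', rfl⟩ := Submodule.mem_sup.mp hy
  obtain ⟨p, hp', z, hz', rfl⟩ := Submodule.mem_sup.mp hw
  rw [lie_add, lie_add]
  exact add_mem (add_mem (Submodule.mem_sup_left (Submodule.mem_sup_right (hp p hp'))) (hz z hz'))
    (Submodule.mem_sup_left (Submodule.mem_sup_right (hm m hm')))

/-- In a simple Lie algebra, the ideal attached to a nonempty set of roots is everything. -/
lemma eq_top_of_nonempty [FiniteDimensional ℂ L] [IsSimple ℂ L]
    (h : D.IsCompatible C N Δp lam) (hne : (D.idealRoots C N lam).Nonempty) :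
    D.sumRootSpaces (-D.idealRoots C N lam) ⊔ D.sumBrackets C N lam ⊔
      D.sumRootSpaces (D.idealRoots C N lam) = ⊤ := by
  set J := D.sumRootSpaces (-D.idealRoots C N lam) ⊔ D.sumBrackets C N lam ⊔
      D.sumRootSpaces (D.idealRoots C N lam)
  let I : LieIdeal ℂ L :=
    { J with
      lie_mem := fun {x y} hy ↦ by
        have : x ∈ J.lieStabilizer := h.lieStabilizer_eq_top ▸ Submodule.mem_top
        exact this y hy }
  have hI : I.toSubmodule = J := rfl
  obtain hb | ht := IsSimple.eq_bot_or_eq_top I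
  · obtain ⟨β, hβ⟩ := hne
    obtain ⟨x, hx, hx0⟩ := D.exists_ne_zero (h.subset_right hβ.1)
    refine absurd ?_ hx0
    have : x ∈ I.toSubmodule := Submodule.mem_sup_right (mem_sumRootSpaces hβ hx)
    simpa [hb] using this
  · rw [← hI, ht, LieSubmodule.top_toSubmodule]

end IsCompatible

end RootDecomposition

/-- `𝔍 = 𝔍₊ ⊕ 𝔍₀ ⊕ 𝔍₋` is a Lie ideal of the simple Lie algebra `𝔤`. -/
theorem J_is_ideal {V : Type*} [NormedAddCommGroup V] [InnerProductSpace ℝ V]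
    [FiniteDimensional ℝ V] (L : Type*) [LieRing L] [LieAlgebra ℂ L]
    [FiniteDimensional ℂ L] [LieAlgebra.IsSimple ℂ L]
    (Δ : Set V) (hRS : IsRootSystem Δ) (D : RootDecomposition Δ L)
    -- the decomposition 𝔤 = 𝔨 ⊕ 𝔭 with 𝔥 ⊆ 𝔨
    (K P : Submodule ℂ L)
    (hsup : K ⊔ P = ⊤) (hinf : K ⊓ P = ⊥)
    (hHK : D.H.toSubmodule ≤ K)
    (hKK : ∀ x ∈ K, ∀ y ∈ K, ⁅x, y⁆ ∈ K)
    (hKP : ∀ x ∈ K, ∀ y ∈ P, ⁅x, y⁆ ∈ P)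
    (hPP : ∀ x ∈ P, ∀ y ∈ P, ⁅x, y⁆ ∈ K)
    -- the induced partition of the roots into compact and noncompact ones
    (Δc Δnc : Set V)
    (hΔc : Δc = {α ∈ Δ | D.rootSpace α ≤ K})
    (hΔnc : Δnc = {α ∈ Δ | D.rootSpace α ≤ P})
    (hpartition : Δc ∪ Δnc = Δ ∧ Δc ∩ Δnc = ∅)
    -- a choice of positive roots and the weight λ
    (Δp : Set V) (hPS : IsPositiveSystem Δ Δp)
    (lam : V)
    (h1 : ∀ α ∈ Δc ∩ Δp, 0 ≤ ⟪lam, α⟫)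
    (h2 : ∀ β ∈ Δnc ∩ Δp, ⟪lam, β⟫ ≤ 0)
    -- the sets Δ₊^{nc,1}, Δ₊^{nc,2}
    (nc1 nc2 : Set V)
    (hnc1 : nc1 = {β | β ∈ Δnc ∩ Δp ∧ ⟪lam, β⟫ < 0})
    (hnc2 : nc2 = {β | β ∈ Δnc ∩ Δp ∧ ⟪lam, β⟫ = 0 ∧
      ∃ α ∈ Δc ∩ Δp, ∃ β' ∈ nc1, β = α + β'})
    -- the subspaces 𝔍₋, 𝔍₊, 𝔍₀
    (Jm Jp J0 : Submodule ℂ L)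
    (hJm : Jm = ⨆ β ∈ nc1 ∪ nc2, D.rootSpace β)
    (hJp : Jp = ⨆ β ∈ nc1 ∪ nc2, D.rootSpace (-β))
    (hJ0 : J0 = Submodule.span ℂ {z : L | ∃ x ∈ Jp, ∃ y ∈ Jm, z = ⁅x, y⁆}) :
    ∀ x : L, ∀ y ∈ Jp ⊔ J0 ⊔ Jm, ⁅x, y⁆ ∈ Jp ⊔ J0 ⊔ Jm := by
  have hdisj : ∀ x ∈ K, x ∈ P → x = 0 := Submodule.disjoint_def.mp (disjoint_iff.mpr hinf)
  have hPK : ∀ x ∈ P, ∀ y ∈ K, ⁅x, y⁆ ∈ P := fun x hx y hy ↦ by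
    rw [← lie_skew, neg_mem_iff]
    exact hKP y hy x hx
  have hc : ∀ α ∈ Δc, α ∈ Δ ∧ D.rootSpace α ≤ K := fun α hα ↦ by simpa [hΔc] using hα
  have hn : ∀ α ∈ Δnc, α ∈ Δ ∧ D.rootSpace α ≤ P := fun α hα ↦ by simpa [hΔnc] using hα
  have hmem : ∀ α ∈ Δ, α ∈ Δc ∨ α ∈ Δnc := fun α hα ↦ hpartition.1.superset hα
  have hcomp : D.IsCompatible Δc Δnc Δp lam :=
    { isRootSystem := hRS
      isPositiveSystem := hPS
      subset_left := fun α hα ↦ (hc α hα).1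
      subset_right := fun α hα ↦ (hn α hα).1
      mem_or_mem := hmem
      notMem := fun α hα hα' ↦ hpartition.2.subset ⟨hα, hα'⟩
      neg_mem_left := fun α hα ↦ by
        refine (hmem _ (hRS.neg_mem_s10 (hc α hα).1)).resolve_right fun h ↦ ?_
        obtain ⟨x, hx, y, hy, hxy⟩ := D.linked_neg_self (hc α hα).1
        exact hxy (hdisj _ (hHK (D.bracket_neg α (hc α hα).1 x hx y hy))
          (hKP x ((hc α hα).2 hx) y ((hn _ h).2 hy)))
      neg_mem_right := fun α hα ↦ by
        refine (hmem _ (hRS.neg_mem_s10 (hn α hα).1)).resolve_left fun h ↦ ?_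
        obtain ⟨x, hx, y, hy, hxy⟩ := D.linked_neg_self (hn α hα).1
        exact hxy (hdisj _ (hHK (D.bracket_neg α (hn α hα).1 x hx y hy))
          (hPK x ((hn α hα).2 hx) y ((hc _ h).2 hy)))
      add_mem_of_left_left := fun α hα β hβ ⟨x, hx, y, hy, hxy⟩ hm ↦ by
        refine (hmem _ hm).resolve_right fun h ↦ hxy (hdisj _
          (hKK x ((hc α hα).2 hx) y ((hc β hβ).2 hy)) ((hn _ h).2 ?_))
        exact D.bracket_root_root α (hc α hα).1 β (hc β hβ).1 hm x hx y hy
      add_mem_of_left_right := fun α hα β hβ ⟨x, hx, y, hy, hxy⟩ hm ↦ by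
        refine (hmem _ hm).resolve_left fun h ↦ hxy (hdisj _ ((hc _ h).2 ?_)
          (hKP x ((hc α hα).2 hx) y ((hn β hβ).2 hy)))
        exact D.bracket_root_root α (hc α hα).1 β (hn β hβ).1 hm x hx y hy
      add_mem_of_right_right := fun α hα β hβ ⟨x, hx, y, hy, hxy⟩ hm ↦ by
        refine (hmem _ hm).resolve_right fun h ↦ hxy (hdisj _
          (hPP x ((hn α hα).2 hx) y ((hn β hβ).2 hy)) ((hn _ h).2 ?_))
        exact D.bracket_root_root α (hn α hα).1 β (hn β hβ).1 hm x hx y hy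
      inner_nonneg := fun α hα hp ↦ h1 α ⟨hα, hp⟩
      inner_nonpos := fun α hα hp ↦ h2 α ⟨hα, hp⟩ }
  obtain hS | hS := (D.idealRoots Δc Δnc lam).eq_empty_or_nonempty
  · have hnc1' : nc1 = ∅ := by
      refine Set.eq_empty_of_forall_notMem fun β hβ ↦ ?_
      rw [hnc1] at hβ
      exact hS.subset (RootDecomposition.IsCompatible.mem_idealRoots_of_inner_neg hβ.1.1 hβ.2)
    have hnc2' : nc2 = ∅ := by simp [hnc2, hnc1']
    have hJm' : Jm = ⊥ := by simp [hJm, hnc1', hnc2']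
    have hJp' : Jp = ⊥ := by simp [hJp, hnc1', hnc2']
    have hJ0' : J0 = ⊥ := by simp [hJ0, hJp', hJm']
    simp [hJm', hJp', hJ0']
  · have hsub : D.idealRoots Δc Δnc lam ⊆ nc1 ∪ nc2 := by
      intro β hβ
      have hβp := hcomp.idealRoots_subset_pos hβ
      obtain ⟨hβN, hneg | ⟨h0, α, hα, γ, hγ, hγ0, hsum, -⟩⟩ := hβ
      · exact .inl (hnc1 ▸ ⟨⟨hβN, hβp⟩, hneg⟩)
      · right
        have hα0 : 0 < ⟪lam, α⟫ := by
          rw [← hsum, inner_add_right] at h0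
          linarith
        rw [hnc2]
        exact ⟨⟨hβN, hβp⟩, h0, α, ⟨hα, hcomp.pos_of_inner_pos hα hα0⟩, γ,
          hnc1 ▸ ⟨⟨hγ, hcomp.pos_of_inner_neg hγ hγ0⟩, hγ0⟩, hsum.symm⟩
    have hm : D.sumRootSpaces (D.idealRoots Δc Δnc lam) ≤ Jm := hJm ▸ biSup_mono hsub
    have hp : D.sumRootSpaces (-D.idealRoots Δc Δnc lam) ≤ Jp := by
      refine D.sumRootSpaces_le.mpr fun β hβ x hx ↦ ?_
      rw [hJp]
      exact Submodule.mem_iSup_of_mem (-β) (Submodule.mem_iSup_of_mem (hsub hβ)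
        ((neg_neg β).symm ▸ hx))
    have h0 : D.sumBrackets Δc Δnc lam ≤ J0 := by
      rw [hJ0]
      refine Submodule.span_mono ?_
      rintro _ ⟨x, hx, y, hy, rfl⟩
      exact ⟨x, hp hx, y, hm hy, rfl⟩
    have htop : Jp ⊔ J0 ⊔ Jm = ⊤ :=
      top_le_iff.mp (hcomp.eq_top_of_nonempty hS ▸ sup_le_sup (sup_le_sup hp h0) hm)
    simp [htop]
end

section
/- Assume that for every nonzero λ ∈ V there exists α ∈ Δ₊^c with (λ,α) < 0 or β ∈ Δ₊^nc with (λ,β) > 0. Then for every simple root β of Δ₊ with β ∈ Δ₊^nc there exist α ∈ Δ₊^c and β' ∈ Δ₊^nc such that β = α − β'. -/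
open scoped RealInnerProductSpace

/-- The difference of two distinct roots at an acute angle is a root. -/
theorem IsRootSystem.sub_mem_of_inner_pos_s11 {V : Type*} [NormedAddCommGroup V]
    [InnerProductSpace ℝ V] [FiniteDimensional ℝ V] {Δ : Set V} (hΔ : IsRootSystem Δ)
    {α β : V} (hα : α ∈ Δ) (hβ : β ∈ Δ) (hne : α ≠ β) (hpos : 0 < ⟪α, β⟫) : α - β ∈ Δ := by
  have hα0 : 0 < ⟪α, α⟫ :=
    real_inner_self_pos.2 fun h => hΔ.zero_not_mem (h ▸ hα)
  have hβ0 : 0 < ⟪β, β⟫ :=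
    real_inner_self_pos.2 fun h => hΔ.zero_not_mem (h ▸ hβ)
  obtain ⟨m, hm⟩ := hΔ.crystallographic β hβ α hα
  obtain ⟨n, hn⟩ := hΔ.crystallographic α hα β hβ
  have hrβ := hΔ.reflection_mem β hβ α hα
  have hrα := hΔ.reflection_mem α hα β hβ
  rw [hm] at hrβ
  rw [hn] at hrα
  rw [real_inner_comm α β] at hn
  have hm0 : 0 < m := by
    have : (0 : ℝ) < m := hm ▸ by positivity
    exact_mod_cast this
  have hn0 : 0 < n := by
    have : (0 : ℝ) < n := hn ▸ by positivity
    exact_mod_cast this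
  rw [div_eq_iff hβ0.ne'] at hm
  rw [div_eq_iff hα0.ne'] at hn
  by_cases hm1 : m = 1
  · simpa [hm1] using hrβ
  by_cases hn1 : n = 1
  · have h : β - α ∈ Δ := by simpa [hn1] using hrα
    have h' := hΔ.reflection_mem _ h _ h
    have h0 : ⟪β - α, β - α⟫ ≠ 0 :=
      inner_self_ne_zero.2 (sub_ne_zero.2 hne.symm)
    rw [mul_div_cancel_right₀ _ h0] at h'
    convert h' using 1
    module
  exfalso
  have hm2 : (2 : ℝ) ≤ m := by exact_mod_cast (by omega : 2 ≤ m)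
  have hn2 : (2 : ℝ) ≤ n := by exact_mod_cast (by omega : 2 ≤ n)
  have hle : ⟪α - β, α - β⟫ ≤ 0 := by
    rw [real_inner_sub_sub_self]
    nlinarith
  exact hne (sub_eq_zero.1 (real_inner_self_nonpos.1 hle))

/-- Under condition (2), every noncompact simple root `β` of `Δ₊` can be written as
`β = α - β'` with `α ∈ Δ₊^c` and `β' ∈ Δ₊^nc`. -/
theorem simple_noncompact_eq_compact_sub_noncompact {V : Type*} [NormedAddCommGroup V]
    [InnerProductSpace ℝ V] [FiniteDimensional ℝ V] (Δ Δc Δnc Δp : Set V)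
    (hRS : IsRootSystem Δ) (hCD : IsCompactDecomp Δ Δc Δnc) (hPS : IsPositiveSystem Δ Δp)
    (hcond : ∀ lam : V, lam ≠ 0 →
      (∃ α ∈ Δc ∩ Δp, ⟪lam, α⟫ < 0) ∨ (∃ β ∈ Δnc ∩ Δp, 0 < ⟪lam, β⟫))
    (β : V) (hβp : β ∈ Δp) (hβsimple : ¬ ∃ γ ∈ Δp, ∃ δ ∈ Δp, β = γ + δ)
    (hβnc : β ∈ Δnc) :
    ∃ α ∈ Δc ∩ Δp, ∃ β' ∈ Δnc ∩ Δp, β = α - β' := by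
  by_contra hcontra
  have hβ : β ∈ Δ := hPS.subset hβp
  have hnβ : -β ∈ Δnc := hCD.neg_nc β hβnc
  have hnβΔ : -β ∈ Δ := hCD.union_eq ▸ Or.inr hnβ
  have hadd : ∀ γ ∈ Δnc ∩ Δp, γ + β ∉ Δ := fun γ hγ h =>
    hcontra ⟨γ + β, ⟨hCD.add_ncnc γ hγ.1 β hβnc h, hPS.add_mem γ hγ.2 β hβp h⟩, γ, hγ,
      (add_sub_cancel_left γ β).symm⟩
  have hβ0 : -β ≠ 0 := fun h => hRS.zero_not_mem (h ▸ hnβΔ)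
  rcases hcond (-β) hβ0 with ⟨α, ⟨hαc, hαp⟩, h⟩ | ⟨γ, hγ, h⟩
  · have hne : α ≠ β := fun he =>
      (hCD.inter_eq ▸ (⟨he ▸ hαc, hβnc⟩ : β ∈ Δc ∩ Δnc) : β ∈ (∅ : Set V))
    have hsub : α - β ∈ Δ := hRS.sub_mem_of_inner_pos_s11 (hPS.subset hαp) hβ hne (by
      rw [inner_neg_left, real_inner_comm] at h
      linarith)
    have hsub_nc : α - β ∈ Δnc := by
      rw [sub_eq_add_neg] at hsub ⊢
      exact hCD.add_cnc α hαc _ hnβ hsub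
    rcases hPS.mem_or_neg_mem _ hsub with hp | hp
    · exact hadd _ ⟨hsub_nc, hp⟩ (by simpa using hPS.subset hαp)
    · exact hβsimple ⟨α, hαp, _, hp, by abel⟩
  · refine hadd γ hγ ?_
    rw [← sub_neg_eq_add]
    refine hRS.sub_mem_of_inner_pos_s11 (hPS.subset hγ.2) hnβΔ ?_ (by rwa [real_inner_comm])
    rintro rfl
    exact hPS.neg_not_mem β hβp hγ.2
end

section
/- Let 𝔤 be a finite-dimensional complex semisimple Lie algebra, 𝔥 ⊆ 𝔤 a Cartan subalgebra, and 𝔟 ⊆ 𝔤 a Lie subalgebra with 𝔥 ⊆ 𝔟. Then 𝔟 equals its own normalizer in 𝔤: {X ∈ 𝔤 : ⁅X,𝔟⁆ ⊆ 𝔟} = 𝔟. -/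
open LieAlgebra LieModule in
/-- A triangularizable Cartan subalgebra contains an Engel subalgebra. -/
lemma LieSubalgebra.IsCartanSubalgebra.exists_engel_le {K L : Type*} [Field K] [CharZero K]
    [LieRing L] [LieAlgebra K L] [FiniteDimensional K L]
    (H : LieSubalgebra K L) [H.IsCartanSubalgebra] [IsTriangularizable K H L] :
    ∃ x : L, LieSubalgebra.engel K x ≤ H := by
  obtain ⟨h, hh⟩ := Module.Dual.exists_forall_ne_zero_of_forall_exists
    (fun χ : {χ : Weight K H L // χ.IsNonZero} ↦ χ.1.toLinear) fun χ ↦ by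
      by_contra! hχ
      exact χ.2 (funext hχ)
  refine ⟨h, fun y hy ↦ ?_⟩
  let W : Submodule K L := (rootSpace H (0 : H → K)).toSubmodule
  let E : K → Submodule K L := (ad K L h).maxGenEigenspace
  let V : Submodule K L := ⨆ μ, ⨆ (_ : μ ≠ 0), E μ
  have hle (χ : H → K) : (rootSpace H χ).toSubmodule ≤ E (χ h) :=
    genWeightSpace_le_genWeightSpaceOf L h χ
  have hdisj : Disjoint (E 0) V := (ad K L h).independent_maxGenEigenspace 0
  have htop : W ⊔ V = ⊤ := by
    have key : ⨆ χ : Weight K H L, (rootSpace H χ).toSubmodule = ⊤ := by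
      rw [← LieSubmodule.iSup_toSubmodule, iSup_genWeightSpace_eq_top' K H L,
        LieSubmodule.top_toSubmodule]
    rw [eq_top_iff, ← key, iSup_le_iff]
    intro χ
    by_cases hχ : χ.IsZero
    · rw [Weight.IsZero] at hχ
      rw [hχ]
      exact le_sup_left
    · exact (hle χ).trans <| le_sup_of_le_right <| le_iSup₂_of_le (χ h) (hh ⟨χ, hχ⟩) le_rfl
  have hEW : E 0 ≤ W := by
    have hWE : W ≤ E 0 := hle 0
    rw [← inf_top_eq (E 0), ← htop, inf_comm, sup_inf_assoc_of_le V hWE, inf_comm,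
      hdisj.eq_bot, sup_bot_eq]
  simpa [W] using hEW hy

/-- A Lie subalgebra of a finite-dimensional complex semisimple Lie algebra containing a
Cartan subalgebra equals its own normalizer. -/
theorem subalgebra_containing_cartan_self_normalizing {L : Type*} [LieRing L]
    [LieAlgebra ℂ L] [FiniteDimensional ℂ L] [LieAlgebra.IsSemisimple ℂ L]
    (H B : LieSubalgebra ℂ L) (hH : H.IsCartanSubalgebra) (hHB : H ≤ B) :
    {X : L | ∀ b ∈ B, ⁅X, b⁆ ∈ B} = (B : Set L) := by
  obtain ⟨x, hx⟩ := LieSubalgebra.IsCartanSubalgebra.exists_engel_le H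
  have hB := LieSubalgebra.normalizer_eq_self_of_engel_le B x (hx.trans hHB)
  ext X
  exact (B.mem_normalizer_iff X).symm.trans (SetLike.ext_iff.mp hB X)
end

section
/- Let 𝔤 = ⨁_{k∈ℤ} 𝔤^k be a ℤ-graded Lie algebra over a field (⁅𝔤^k,𝔤^l⁆ ⊆ 𝔤^{k+l}, finitely many nonzero summands), and let σ : 𝔤 → 𝔤 be an involutive Lie algebra automorphism with σ(𝔤^k) = 𝔤^{−k} for all k. Set 𝔳 := 𝔤⁰, 𝔨 := ⨁_{k even} 𝔤^k, 𝔭 := ⨁_{k odd} 𝔤^k, and 𝔨₋ := ⨁_{k<0, k even} 𝔤^k. Suppose 𝔭₋^R ⊆ 𝔭 is a submodule with ⁅𝔨, 𝔭₋^R⁆ ⊆ 𝔭₋^R, 𝔭 = 𝔭₋^R ⊕ σ(𝔭₋^R), and ⁅𝔭₋^R, 𝔭₋^R⁆ = 0. Then 𝔫₋^R := 𝔨₋ ⊕ 𝔭₋^R satisfies: ⁅𝔳, 𝔫₋^R⁆ ⊆ 𝔫₋^R; 𝔫₋^R ⊕ σ(𝔫₋^R) = ⨁_{k≠0} 𝔤^k;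 and ⁅𝔫₋^R, 𝔫₋^R⁆ ⊆ 𝔫₋^R, so 𝔫₋^R is a Lie subalgebra of 𝔤. -/
theorem lie_mem_biSup_of_graded {k L : Type*} [CommRing k] [LieRing L] [LieAlgebra k L]
    {G : ℤ → Submodule k L}
    (hbracket : ∀ m n : ℤ, ∀ x ∈ G m, ∀ y ∈ G n, ⁅x, y⁆ ∈ G (m + n))
    {s t u : Set ℤ} (hstu : ∀ m ∈ s, ∀ n ∈ t, m + n ∈ u)
    {x y : L} (hx : x ∈ ⨆ n ∈ s, G n) (hy : y ∈ ⨆ n ∈ t, G n) :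
    ⁅x, y⁆ ∈ ⨆ n ∈ u, G n := by
  rw [iSup_subtype'] at hx hy
  induction hx using Submodule.iSup_induction' with
  | zero => simp
  | add a b _ _ ha hb => rw [add_lie]; exact add_mem ha hb
  | mem m a ha =>
    induction hy using Submodule.iSup_induction' with
    | zero => simp
    | add b c _ _ hb hc => rw [lie_add]; exact add_mem hb hc
    | mem n b hb =>
      exact le_iSup₂_of_le (f := fun n (_ : n ∈ u) => G n) _ (hstu m m.2 n n.2) le_rfl
        (hbracket m n a ha b hb)

theorem map_biSup_of_map_eq_neg {k L : Type*} [Semiring k] [AddCommMonoid L] [Module k L]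
    {G : ℤ → Submodule k L} {f : L →ₗ[k] L} (hf : ∀ n : ℤ, (G n).map f = G (-n)) (s : Set ℤ) :
    (⨆ n ∈ s, G n).map f = ⨆ n ∈ -s, G n := by
  simp only [Submodule.map_iSup, hf]
  exact (Equiv.neg ℤ).iSup_congr fun n => by simp

theorem disjoint_sup_sup_of_disjoint {k L : Type*} [Ring k] [AddCommGroup L] [Module k L]
    {A A' B B' : Submodule k L} (hA : Disjoint A A') (hB : Disjoint B B')
    (hAB : Disjoint (A ⊔ A') (B ⊔ B')) : Disjoint (A ⊔ B) (A' ⊔ B') := by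
  rw [Submodule.disjoint_def] at hA hB hAB ⊢
  intro x hx hx'
  obtain ⟨a, ha, b, hb, rfl⟩ := Submodule.mem_sup.1 hx
  obtain ⟨a', ha', b', hb', h⟩ := Submodule.mem_sup.1 hx'
  have hsub : a - a' = b' - b := by
    rw [sub_eq_sub_iff_add_eq_add, ← h, add_comm]
  have h0 : a - a' = 0 := by
    refine hAB _ (sub_mem (Submodule.mem_sup_left ha) (Submodule.mem_sup_right ha')) ?_
    rw [hsub]
    exact sub_mem (Submodule.mem_sup_right hb') (Submodule.mem_sup_left hb)
  have haa : a = a' := sub_eq_zero.1 h0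
  have hbb : b' = b := sub_eq_zero.1 (hsub ▸ h0)
  rw [hA a ha (haa ▸ ha'), hB b hb (hbb ▸ hb'), add_zero]

/-- Lie-algebraic construction of the new invariant complex structure: in a ℤ-graded
Lie algebra with an involution `σ` exchanging `𝔤^k` and `𝔤^{-k}`, given an abelian,
`⁅𝔨,·⁆`-stable complement `𝔭₋^R` of `σ(𝔭₋^R)` in `𝔭`, the submodule
`𝔫₋^R = 𝔨₋ ⊕ 𝔭₋^R` is `ad 𝔳`-stable, complementary to `σ(𝔫₋^R)` in `⨁_{k≠0} 𝔤^k`,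
and a Lie subalgebra. -/
theorem new_complex_structure_subalgebra {k L : Type*} [Field k] [LieRing L] [LieAlgebra k L]
    (G : ℤ → Submodule k L)
    (hdecomp : DirectSum.IsInternal G)
    (hfin : {n : ℤ | G n ≠ ⊥}.Finite)
    (hbracket : ∀ m n : ℤ, ∀ x ∈ G m, ∀ y ∈ G n, ⁅x, y⁆ ∈ G (m + n))
    (σ : L →ₗ⁅k⁆ L) (hσinv : ∀ x : L, σ (σ x) = x)
    (hσgrade : ∀ n : ℤ, (G n).map σ.toLinearMap = G (-n))
    (K P Kneg : Submodule k L)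
    (hK : K = ⨆ n ∈ {m : ℤ | Even m}, G n)
    (hP : P = ⨆ n ∈ {m : ℤ | Odd m}, G n)
    (hKneg : Kneg = ⨆ n ∈ {m : ℤ | m < 0 ∧ Even m}, G n)
    (PR : Submodule k L) (hPRP : PR ≤ P)
    (hKPR : ∀ x ∈ K, ∀ y ∈ PR, ⁅x, y⁆ ∈ PR)
    (hPsup : PR ⊔ PR.map σ.toLinearMap = P)
    (hPinf : PR ⊓ PR.map σ.toLinearMap = ⊥)
    (hPRabelian : ∀ x ∈ PR, ∀ y ∈ PR, ⁅x, y⁆ = 0) :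
    (∀ x ∈ G 0, ∀ y ∈ Kneg ⊔ PR, ⁅x, y⁆ ∈ Kneg ⊔ PR) ∧
    ((Kneg ⊔ PR) ⊔ (Kneg ⊔ PR).map σ.toLinearMap = ⨆ n ∈ {m : ℤ | m ≠ 0}, G n) ∧
    ((Kneg ⊔ PR) ⊓ (Kneg ⊔ PR).map σ.toLinearMap = ⊥) ∧
    (∀ x ∈ Kneg ⊔ PR, ∀ y ∈ Kneg ⊔ PR, ⁅x, y⁆ ∈ Kneg ⊔ PR) := by
  have hdisj {s t : Set ℤ} (hst : Disjoint s t) : Disjoint (⨆ n ∈ s, G n) (⨆ n ∈ t, G n) :=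
    hdecomp.submodule_iSupIndep.disjoint_biSup_biSup hst
  have hKneg_map : Kneg.map σ.toLinearMap = ⨆ n ∈ {m : ℤ | 0 < m ∧ Even m}, G n := by
    rw [hKneg, map_biSup_of_map_eq_neg hσgrade]
    congr! 3 with n
    simp
  have hKneg_sup : Kneg ⊔ Kneg.map σ.toLinearMap = ⨆ n ∈ {m : ℤ | m ≠ 0 ∧ Even m}, G n := by
    rw [hKneg_map, hKneg, ← iSup_union]
    congr! 3 with n
    simp only [Set.mem_union, Set.mem_ofPred_eq]
    grind
  have hKnegK : Kneg ≤ K := by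
    rw [hKneg, hK]
    exact biSup_mono fun n hn => hn.2
  have hG0K : G 0 ≤ K := by
    rw [hK]
    exact le_iSup₂_of_le (f := fun n (_ : n ∈ {m : ℤ | Even m}) => G n) 0 Even.zero le_rfl
  refine ⟨fun x hx y hy => ?_, ?_, ?_, fun x hx y hy => ?_⟩
  · obtain ⟨a, ha, b, hb, rfl⟩ := Submodule.mem_sup.1 hy
    rw [lie_add]
    refine Submodule.add_mem_sup ?_ (hKPR x (hG0K hx) b hb)
    rw [hKneg] at ha ⊢
    exact lie_mem_biSup_of_graded hbracket (s := {0}) (by simp +contextual) (by simpa using hx) ha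
  · rw [Submodule.map_sup, sup_sup_sup_comm, hKneg_sup, hPsup, hP, ← iSup_union]
    congr! 3 with n
    simp only [Set.mem_union, Set.mem_ofPred_eq]
    grind
  · rw [Submodule.map_sup, ← disjoint_iff]
    refine disjoint_sup_sup_of_disjoint ?_ (disjoint_iff.2 hPinf) ?_
    · rw [hKneg_map, hKneg]
      exact hdisj (Set.disjoint_left.2 fun n hn hn' => hn.1.not_gt hn'.1)
    · rw [hKneg_sup, hPsup, hP]
      exact hdisj (Set.disjoint_left.2 fun n hn hn' => Int.not_even_iff_odd.2 hn' hn.2)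
  · obtain ⟨a, ha, b, hb, rfl⟩ := Submodule.mem_sup.1 hx
    obtain ⟨c, hc, d, hd, rfl⟩ := Submodule.mem_sup.1 hy
    have hac : ⁅a, c⁆ ∈ Kneg := by
      rw [hKneg] at ha hc ⊢
      exact lie_mem_biSup_of_graded hbracket
        (u := {m | m < 0 ∧ Even m})
        (fun m hm n hn => ⟨add_neg hm.1 hn.1, hm.2.add hn.2⟩) ha hc
    have hbc : ⁅b, c⁆ ∈ PR := by
      rw [← lie_skew]
      exact neg_mem (hKPR c (hKnegK hc) b hb)
    rw [add_lie, lie_add, lie_add, hPRabelian b hb d hd, add_zero, add_assoc]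
    exact Submodule.add_mem_sup hac (add_mem (hKPR a (hKnegK ha) d hd) hbc)
end
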